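/- Let ε ≥ 0, α, β, γ > 0, δ ≥ 0, K, M, C̃ > 0, T > 0. For i = 1, 2 let (uᵢ, ωᵢ, σᵢ) be smooth, ℤ³-periodic-in-space solutions on ℝ³×[0,T] of the regularized vorticity system ∂ₜωᵢ − αΔωᵢ + (Juᵢ·∇)ωᵢ + Ω(Juᵢ,uᵢ) = β(∇×div Jσᵢ) + g and ∂ₜσᵢ = εΔσᵢ − (Juᵢ·∇)σᵢ + (∇Juᵢ)σᵢ + σᵢ(∇Juᵢ)ᵀ − γσᵢ + δI, with ωᵢ = ∇×uᵢ, ∇·uᵢ = 0 and the same forcing g. Assume: (i) for every ℤ³-periodic scalar f and every x, |Jf(x)| + |(∇Jf)(x)| ≤ K‖f‖_{L²}; (ii) ‖u₂(·,t) − u₁(·,t)‖²_{L²} + ‖∇(u₂ − u₁)(·,t)‖²_{L²} ≤ C̃ ‖ω₂(·,t) − ω₁(·,t)‖²_{L²} for every t; (iii) ‖ω₁(·,t)‖_{L²}, ‖ω₂(·,t)‖_{L²}, ‖∇ω₁(·,t)‖_{L²}, ‖σ₁(·,t)‖_{L²}, ‖∇σ₁(·,t)‖_{L²} ≤ M for all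 t ∈ [0,T]. Then there is a constant C, depending only on α, β, γ, K, M, C̃, such that for all t ∈ [0,T]: ‖ω₂(·,t) − ω₁(·,t)‖²_{L²} + ‖σ₂(·,t) − σ₁(·,t)‖²_{L²} ≤ e^{Ct} ( ‖ω₂(·,0) − ω₁(·,0)‖²_{L²} + ‖σ₂(·,0) − σ₁(·,0)‖²_{L²} ). -/

import Mathlib

open MeasureTheory

noncomputable section

abbrev V3 := Fin 3 → ℝ

/-- spatial partial derivative ∂ᵢf -/
def pd (i : Fin 3) (f : V3 → ℝ) (x : V3) : ℝ := fderiv ℝ f x (Pi.single i 1)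

/-- Laplacian of a scalar function -/
def lap (f : V3 → ℝ) (x : V3) : ℝ := ∑ i, pd i (pd i f) x

/-- ℤ³-periodicity -/
def Periodic3 (f : V3 → ℝ) : Prop :=
  ∀ (x : V3) (k : Fin 3 → ℤ), f (x + fun i => (k i : ℝ)) = f x

/-- mollification Jf = η ∗ f -/
def J3 (η f : V3 → ℝ) (x : V3) : ℝ := ∫ y, η (x - y) * f y

/-- curl ∇×u -/
def curl3 (u : V3 → V3) (x : V3) : V3 :=
  ![pd 1 (fun y => u y 2) x - pd 2 (fun y => u y 1) x,
    pd 2 (fun y => u y 0) x - pd 0 (fun y => u y 2) x,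
    pd 0 (fun y => u y 1) x - pd 1 (fun y => u y 0) x]

/-- (v·∇)u -/
def advect (v u : V3 → V3) (x : V3) : V3 :=
  fun i => ∑ j, v x j * pd j (fun y => u y i) x

/-- the bilinear term Ω(v,u) -/
def Omg (v u : V3 → V3) (x : V3) : V3 :=
  ![∑ j, (pd 1 (fun y => v y j) x * pd j (fun y => u y 2) x
      - pd 2 (fun y => v y j) x * pd j (fun y => u y 1) x),
    ∑ j, (pd 2 (fun y => v y j) x * pd j (fun y => u y 0) x
      - pd 0 (fun y => v y j) x * pd j (fun y => u y 2) x),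
    ∑ j, (pd 0 (fun y => v y j) x * pd j (fun y => u y 1) x
      - pd 1 (fun y => v y j) x * pd j (fun y => u y 0) x)]

/-- the mollified velocity field Ju(·,t) -/
def Jvec (η : V3 → ℝ) (u : V3 → ℝ → V3) (t : ℝ) : V3 → V3 :=
  fun y i => J3 η (fun z => u z t i) y

/-- the vector field div(Jσ)(·,t) -/
def divJσ (η : V3 → ℝ) (σ : V3 → ℝ → Matrix (Fin 3) (Fin 3) ℝ) (t : ℝ) : V3 → V3 :=
  fun y i => ∑ j, pd j (J3 η (fun z => σ z t i j)) y

/-- `(u, ω, σ)` is a smooth, ℤ³-periodic-in-space solution on ℝ³×[0,T] of the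
regularized vorticity system with forcing g:
  ∂ₜω − αΔω + (Ju·∇)ω + Ω(Ju,u) = β(∇×div Jσ) + g,
  ∂ₜσ = εΔσ − (Ju·∇)σ + (∇Ju)σ + σ(∇Ju)ᵀ − γσ + δI,
  ω = ∇×u, ∇·u = 0. -/
def IsVortSolution (η : V3 → ℝ) (α β γ δ ε T : ℝ) (g : V3 → ℝ → V3)
    (u ω : V3 → ℝ → V3) (σ : V3 → ℝ → Matrix (Fin 3) (Fin 3) ℝ) : Prop :=
  (∀ i, ContDiff ℝ (⊤:ℕ∞) (fun q : V3 × ℝ => u q.1 q.2 i)) ∧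
  (∀ i, ContDiff ℝ (⊤:ℕ∞) (fun q : V3 × ℝ => ω q.1 q.2 i)) ∧
  (∀ i j, ContDiff ℝ (⊤:ℕ∞) (fun q : V3 × ℝ => σ q.1 q.2 i j)) ∧
  (∀ t i, Periodic3 (fun x => u x t i)) ∧
  (∀ t i, Periodic3 (fun x => ω x t i)) ∧
  (∀ t i j, Periodic3 (fun x => σ x t i j)) ∧
  (∀ (x : V3) (t : ℝ), ω x t = curl3 (fun y => u y t) x) ∧
  (∀ (x : V3) (t : ℝ), (∑ i, pd i (fun y => u y t i) x) = 0) ∧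
  (∀ x : V3, ∀ t ∈ Set.Icc (0:ℝ) T, ∀ i,
    HasDerivWithinAt (fun s => ω x s i)
      (α * lap (fun y => ω y t i) x
        - (∑ j, Jvec η u t x j * pd j (fun y => ω y t i) x)
        - Omg (Jvec η u t) (fun y => u y t) x i
        + β * curl3 (divJσ η σ t) x i
        + g x t i)
      (Set.Icc (0:ℝ) T) t) ∧
  (∀ x : V3, ∀ t ∈ Set.Icc (0:ℝ) T, ∀ i j,
    HasDerivWithinAt (fun s => σ x s i j)
      (ε * lap (fun y => σ y t i j) x
        - (∑ k, Jvec η u t x k * pd k (fun y => σ y t i j) x)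
        + (∑ k, pd k (fun y => Jvec η u t y i) x * σ x t k j)
        + (∑ k, σ x t i k * pd k (fun y => Jvec η u t y j) x)
        - γ * σ x t i j
        + δ * (if i = j then (1:ℝ) else 0))
      (Set.Icc (0:ℝ) T) t)

/-- smooth ℤ³-periodic scalar functions -/
def SmoothPeriodic (f : V3 → ℝ) : Prop := ContDiff ℝ (⊤:ℕ∞) f ∧ Periodic3 f

namespace SmoothPeriodic

variable {f g : V3 → ℝ}

theorem continuous (hf : SmoothPeriodic f) : Continuous f := hf.1.continuous

theorem differentiable (hf : SmoothPeriodic f) : Differentiable ℝ f :=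
  hf.1.differentiable (by simp)

theorem sub (hf : SmoothPeriodic f) (hg : SmoothPeriodic g) :
    SmoothPeriodic (fun x => f x - g x) :=
  ⟨hf.1.sub hg.1, fun x k => by simp only [hf.2 x k, hg.2 x k]⟩

theorem mul (hf : SmoothPeriodic f) (hg : SmoothPeriodic g) :
    SmoothPeriodic (fun x => f x * g x) :=
  ⟨hf.1.mul hg.1, fun x k => by simp only [hf.2 x k, hg.2 x k]⟩

theorem sum {ι : Type*} {s : Finset ι} {F : ι → V3 → ℝ} (hF : ∀ i, SmoothPeriodic (F i)) :
    SmoothPeriodic (fun x => ∑ i ∈ s, F i x) :=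
  ⟨ContDiff.sum fun i _ => (hF i).1, fun x k => Finset.sum_congr rfl fun i _ => (hF i).2 x k⟩

theorem pd (hf : SmoothPeriodic f) (i : Fin 3) : SmoothPeriodic (pd i f) := by
  refine ⟨?_, fun x k => ?_⟩
  · exact (hf.1.fderiv_right (m := (⊤:ℕ∞)) (by simp)).clm_apply contDiff_const
  · have h : (fun y => f (y + fun i => (k i : ℝ))) = f := funext fun y => hf.2 y k
    unfold _root_.pd
    rw [← fderiv_comp_add_right (f := f), h]

end SmoothPeriodic

theorem pd_sub {f g : V3 → ℝ} (hf : SmoothPeriodic f) (hg : SmoothPeriodic g) (i : Fin 3) (x : V3) :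
    pd i (fun y => f y - g y) x = pd i f x - pd i g x := by
  unfold pd
  rw [fderiv_fun_sub (hf.differentiable x) (hg.differentiable x)]
  rfl

theorem pd_mul {f g : V3 → ℝ} (hf : SmoothPeriodic f) (hg : SmoothPeriodic g) (i : Fin 3) (x : V3) :
    pd i (fun y => f y * g y) x = f x * pd i g x + g x * pd i f x := by
  unfold pd
  rw [fderiv_fun_mul (hf.differentiable x) (hg.differentiable x)]
  simp

theorem pd_sum {ι : Type*} {s : Finset ι} {F : ι → V3 → ℝ} (hF : ∀ i, SmoothPeriodic (F i))
    (i : Fin 3) (x : V3) :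
    pd i (fun y => ∑ j ∈ s, F j y) x = ∑ j ∈ s, pd i (F j) x := by
  unfold pd
  rw [fderiv_fun_sum fun j _ => (hF j).differentiable x]
  simp

theorem pd_comm {f : V3 → ℝ} (hf : SmoothPeriodic f) (i j : Fin 3) (x : V3) :
    pd i (pd j f) x = pd j (pd i f) x := by
  have h2 : Differentiable ℝ (fderiv ℝ f) :=
    (hf.1.fderiv_right (m := (⊤:ℕ∞)) (by simp)).differentiable (by simp)
  have key : ∀ v w : V3, fderiv ℝ (fun y => fderiv ℝ f y v) x w
      = fderiv ℝ (fderiv ℝ f) x w v := fun v w => by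
    rw [fderiv_clm_apply (h2 x) (differentiableAt_const v)]
    simp
  have hs : IsSymmSndFDerivAt ℝ f x := hf.1.contDiffAt.isSymmSndFDerivAt (by
    simpa using WithTop.coe_le_coe.2 (le_top : (2:ℕ∞) ≤ ⊤))
  change fderiv ℝ (fun y => fderiv ℝ f y _) x _ = fderiv ℝ (fun y => fderiv ℝ f y _) x _
  rw [key, key]
  exact hs _ _

theorem Continuous.integrableOn_unitCube {f : V3 → ℝ} (hf : Continuous f) :
    IntegrableOn f (Set.Icc (0:V3) 1) :=
  hf.integrableOn_Icc

/-- The integral of a partial derivative of a periodic function over a period cell vanishes. -/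
theorem integral_pd_eq_zero {f : V3 → ℝ} (hf : SmoothPeriodic f) (i : Fin 3) :
    ∫ x in Set.Icc (0:V3) 1, pd i f x = 0 := by
  have hdiv := integral_divergence_of_hasFDerivAt_off_countable' (E := ℝ) (n := 2)
    (0 : V3) 1 (by intro i; simp) (fun j => if j = i then f else 0)
    (fun j x => if j = i then fderiv ℝ f x else 0) ∅ Set.countable_empty
    (fun j => by
      split_ifs
      · exact hf.continuous.continuousOn
      · exact continuousOn_const)
    (fun x _ j => by
      split_ifs
      · exact (hf.differentiable x).hasFDerivAt
      · exact hasFDerivAt_const _ _)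
    (by
      have : (fun x => ∑ j : Fin 3, (if j = i then fderiv ℝ f x else 0) (Pi.single j 1))
          = pd i f := by
        funext x
        rw [Finset.sum_eq_single i]
        · simp [pd]
        · intro j _ hj; simp [hj]
        · simp
      rw [this]
      exact (hf.pd i).continuous.integrableOn_unitCube)
  have hL : ∀ x, ∑ j : Fin 3, (if j = i then fderiv ℝ f x else 0) (Pi.single j 1) = pd i f x := by
    intro x
    rw [Finset.sum_eq_single i]
    · simp [pd]
    · intro j _ hj; simp [hj]
    · simp
  simp only [hL] at hdiv
  rw [hdiv]
  refine Finset.sum_eq_zero fun j _ => ?_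
  by_cases hj : j = i
  · subst hj
    simp only [if_true]
    rw [sub_eq_zero]
    refine integral_congr_ae (Filter.Eventually.of_forall fun y => ?_)
    have := hf.2 (Fin.insertNth j (0:ℝ) y) (Pi.single j 1)
    change f (Fin.insertNth j (1:ℝ) y) = f (Fin.insertNth j (0:ℝ) y)
    rw [← this]
    congr 1
    funext l
    refine Fin.succAboveCases j ?_ (fun m => ?_) l
    · simp
    · simp [Fin.succAbove_ne]
  · simp [hj]

theorem integrable_mul_of_hasCompactSupport {η f : V3 → ℝ} (hη : Continuous η)
    (hc : HasCompactSupport η) (hf : Continuous f) (x : V3) :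
    Integrable (fun y => η (x - y) * f y) := by
  refine Continuous.integrable_of_hasCompactSupport (by fun_prop) ?_
  exact (hc.comp_homeomorph (Homeomorph.subLeft x)).mul_right

section Mollifier

variable {η : V3 → ℝ}

theorem J3_eq_convolution (η f : V3 → ℝ) :
    J3 η f = convolution f η (ContinuousLinearMap.mul ℝ ℝ) volume := by
  funext x
  simp [J3, convolution, mul_comm]

theorem J3_sub (hη : Continuous η) (hc : HasCompactSupport η) {f g : V3 → ℝ} (hf : Continuous f)
    (hg : Continuous g) (x : V3) :
    J3 η (fun y => f y - g y) x = J3 η f x - J3 η g x := by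
  unfold J3
  rw [← integral_sub (integrable_mul_of_hasCompactSupport hη hc hf x)
    (integrable_mul_of_hasCompactSupport hη hc hg x)]
  simp only [mul_sub]

theorem J3_sum (hη : Continuous η) (hc : HasCompactSupport η) {ι : Type*} {s : Finset ι}
    {F : ι → V3 → ℝ} (hF : ∀ i, Continuous (F i)) (x : V3) :
    J3 η (fun y => ∑ i ∈ s, F i y) x = ∑ i ∈ s, J3 η (F i) x := by
  unfold J3
  rw [← integral_finsetSum _ fun i _ => integrable_mul_of_hasCompactSupport hη hc (hF i) x]
  simp only [Finset.mul_sum]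

theorem SmoothPeriodic.J3 (hη : ContDiff ℝ (⊤:ℕ∞) η) (hc : HasCompactSupport η)
    {f : V3 → ℝ} (hf : SmoothPeriodic f) : SmoothPeriodic (J3 η f) := by
  refine ⟨?_, fun x k => ?_⟩
  · rw [J3_eq_convolution]
    exact hc.contDiff_convolution_right _ hf.continuous.locallyIntegrable hη
  · unfold _root_.J3
    rw [← integral_add_right_eq_self _ (fun i => (k i : ℝ))]
    simp only [hf.2 _ k, add_sub_add_right_eq_sub]

theorem pd_J3 (hη : ContDiff ℝ (⊤:ℕ∞) η) (hc : HasCompactSupport η)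
    {f : V3 → ℝ} (hf : SmoothPeriodic f) (i : Fin 3) (x : V3) :
    pd i (J3 η f) x = J3 η (pd i f) x := by
  have h1 : ContDiff ℝ 1 η := hη.of_le (by simp)
  have hl : LocallyIntegrable f volume := hf.continuous.locallyIntegrable
  have hd := hc.hasFDerivAt_convolution_right (ContinuousLinearMap.mul ℝ ℝ)
    hl h1 x
  have hpc : HasCompactSupport (pd i η) := hc.fderiv_apply ℝ _
  have hpη : Continuous (pd i η) := (h1.continuous_fderiv one_ne_zero).clm_apply continuous_const
  rw [← J3_eq_convolution] at hd
  have e1 : pd i (J3 η f) x = ∫ y, pd i η (x - y) * f y := by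
    unfold pd
    rw [hd.fderiv, convolution_precompR_apply _ hl (hc.fderiv ℝ)
      (h1.continuous_fderiv one_ne_zero)]
    simp [convolution, mul_comm]
  have e2 : ∀ y, fderiv ℝ (fun y => η (x - y)) y (Pi.single i 1) = - pd i η (x - y) := by
    intro y
    have hc := ((h1.differentiable one_ne_zero) (x - y)).hasFDerivAt.comp y
      ((hasFDerivAt_id y).const_sub x)
    rw [show fderiv ℝ (fun y => η (x - y)) y = _ from hc.fderiv]
    simp [pd]
  have := integral_mul_fderiv_eq_neg_fderiv_mul_of_integrable (μ := volume) (𝕜 := ℝ)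
    (f := fun y => η (x - y)) (g := f) (v := Pi.single i 1)
    (by
      simp only [e2, neg_mul]
      exact (integrable_mul_of_hasCompactSupport hpη hpc hf.continuous x).neg)
    (integrable_mul_of_hasCompactSupport hη.continuous hc (hf.pd i).continuous x)
    (integrable_mul_of_hasCompactSupport hη.continuous hc hf.continuous x)
    (fun y _ => ((h1.differentiable one_ne_zero).comp
      (differentiable_id.const_sub x)).differentiableAt)
    (fun y _ => hf.differentiable y)
  simp only [e2, neg_mul, integral_neg, neg_neg] at this
  rw [e1, ← this]
  rfl

end Mollifier

section EnergyIdentities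

theorem integral_divergence_eq_zero {F : Fin 3 → V3 → ℝ} (hF : ∀ j, SmoothPeriodic (F j)) :
    ∫ x in Set.Icc (0:V3) 1, ∑ j, pd j (F j) x = 0 := by
  rw [integral_finsetSum _ fun j _ => ((hF j).pd j).continuous.integrableOn_unitCube]
  exact Finset.sum_eq_zero fun j _ => integral_pd_eq_zero (hF j) j

/-- Transport by a divergence-free field preserves the `L²` norm. -/
theorem integral_mul_transport_eq_zero {b : V3 → V3} (hb : ∀ j, SmoothPeriodic (fun x => b x j))
    (hdiv : ∀ x, ∑ j, pd j (fun y => b y j) x = 0) {f : V3 → ℝ} (hf : SmoothPeriodic f) :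
    ∫ x in Set.Icc (0:V3) 1, f x * ∑ j, b x j * pd j f x = 0 := by
  have h := integral_divergence_eq_zero fun j => (hb j).mul (hf.mul hf)
  have e : ∀ x, ∑ j, pd j (fun y => b y j * (f y * f y)) x
      = 2 * (f x * ∑ j, b x j * pd j f x) := fun x => by
    simp only [fun j => pd_mul (hb j) (hf.mul hf) j x, fun j => pd_mul hf hf j x]
    have := hdiv x
    simp only [Fin.sum_univ_three] at this ⊢
    linear_combination f x * f x * this
  simp only [e, integral_const_mul] at h
  linarith

theorem integral_mul_lap_add_eq_zero {f : V3 → ℝ} (hf : SmoothPeriodic f) :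
    ∫ x in Set.Icc (0:V3) 1, (f x * lap f x + ∑ j, (pd j f x) ^ 2) = 0 := by
  have h := integral_divergence_eq_zero fun j => hf.mul (hf.pd j)
  have e : ∀ x, ∑ j, pd j (fun y => f y * pd j f y) x
      = f x * lap f x + ∑ j, (pd j f x) ^ 2 := fun x => by
    simp only [fun j => pd_mul hf (hf.pd j) j x, lap, Fin.sum_univ_three]
    ring
  simpa only [e] using h

theorem integral_dot_curl_sub_eq_zero {w h : V3 → V3} (hw : ∀ i, SmoothPeriodic (fun x => w x i))
    (hh : ∀ i, SmoothPeriodic (fun x => h x i)) :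
    ∫ x in Set.Icc (0:V3) 1,
      ((∑ i, w x i * curl3 h x i) - ∑ i, curl3 w x i * h x i) = 0 := by
  have hx : ∀ i k, SmoothPeriodic (fun x => h x i * w x k - h x k * w x i) := fun i k =>
    ((hh i).mul (hw k)).sub ((hh k).mul (hw i))
  have hi := integral_divergence_eq_zero
    (F := fun j x => h x (j+1) * w x (j+2) - h x (j+2) * w x (j+1))
    fun j => hx _ _
  have ep : ∀ j i k x, pd j (fun x => h x i * w x k - h x k * w x i) x
      = h x i * pd j (fun y => w y k) x + w x k * pd j (fun y => h y i) x
        - (h x k * pd j (fun y => w y i) x + w x i * pd j (fun y => h y k) x) := fun j i k x => by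
    rw [pd_sub ((hh i).mul (hw k)) ((hh k).mul (hw i)), pd_mul (hh i) (hw k),
      pd_mul (hh k) (hw i)]
  simp only [ep] at hi
  rw [← hi]
  refine integral_congr_ae (Filter.Eventually.of_forall fun x => ?_)
  have e1 : (1:Fin 3) + 1 = 2 := rfl
  have e2 : (1:Fin 3) + 2 = 0 := rfl
  have e3 : (2:Fin 3) + 1 = 0 := rfl
  have e4 : (2:Fin 3) + 2 = 1 := rfl
  simp only [curl3, Fin.sum_univ_three, zero_add, e1, e2, e3, e4, Matrix.cons_val]
  ring

/-- For divergence-free periodic fields the `L²` norms of gradient and curl agree. -/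
theorem integral_grad_sq_eq_integral_curl_sq {u : V3 → V3}
    (hu : ∀ i, SmoothPeriodic (fun x => u x i))
    (hdiv : ∀ x, ∑ j, pd j (fun y => u y j) x = 0) :
    ∫ x in Set.Icc (0:V3) 1, ∑ i, ∑ j, (pd j (fun y => u y i) x) ^ 2
      = ∫ x in Set.Icc (0:V3) 1, ∑ i, (curl3 u x i) ^ 2 := by
  have hP : ∀ j i, SmoothPeriodic (fun x => u x i * pd i (fun y => u y j) x) := fun j i =>
    (hu i).mul ((hu j).pd i)
  have hi := integral_divergence_eq_zero
    (F := fun j x => ∑ i, u x i * pd i (fun y => u y j) x) fun j => SmoothPeriodic.sum (hP j)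
  have hddiv : ∀ i x, ∑ j, pd j (pd i (fun y => u y j)) x = 0 := fun i x => by
    have h0 : (fun x => ∑ j, pd j (fun y => u y j) x) = fun _ => (0:ℝ) := funext hdiv
    have := pd_sum (s := Finset.univ) (fun j => (hu j).pd j) i x
    rw [h0] at this
    simp only [pd_comm (hu _) _ i x]
    rw [← this]
    simp [pd]
  have e : ∀ x, ∑ j, pd j (fun x => ∑ i, u x i * pd i (fun y => u y j) x) x
      = (∑ i, ∑ j, (pd j (fun y => u y i) x) ^ 2) - ∑ i, (curl3 u x i) ^ 2 := fun x => by
    have h0 := hddiv 0 x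
    have h1 := hddiv 1 x
    have h2 := hddiv 2 x
    simp only [fun j => pd_sum (s := Finset.univ) (hP j) j x,
      fun i j => pd_mul (hu i) ((hu j).pd i) j x]
    simp only [curl3, Fin.sum_univ_three, Matrix.cons_val] at h0 h1 h2 ⊢
    linear_combination u x 0 * h0 + u x 1 * h1 + u x 2 * h2
  have hc : ∀ i, Continuous (fun x => curl3 u x i) := fun i => by
    have hp : ∀ k l, Continuous (pd k (fun y => u y l)) := fun k l => ((hu l).pd k).continuous
    fin_cases i <;> simp only [curl3, Fin.zero_eta, Fin.mk_one, Fin.reduceFinMk, Matrix.cons_val] <;>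
      exact (hp _ _).sub (hp _ _)
  have hp : ∀ k l, Continuous (pd k (fun y => u y l)) := fun k l => ((hu l).pd k).continuous
  simp only [e] at hi
  rw [integral_sub] at hi
  · linarith
  · exact Continuous.integrableOn_unitCube (by fun_prop)
  · exact Continuous.integrableOn_unitCube (by fun_prop)

end EnergyIdentities

theorem integral_le_of_le_linear_combination {n : ℕ} {Φ : V3 → ℝ} (hΦ : Continuous Φ)
    {c : Fin n → ℝ} {f : Fin n → V3 → ℝ} (hf : ∀ k, Continuous (f k))
    (h : ∀ x, Φ x ≤ ∑ k, c k * f k x) :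
    ∫ x in Set.Icc (0:V3) 1, Φ x ≤ ∑ k, c k * ∫ x in Set.Icc (0:V3) 1, f k x := by
  simp only [← integral_const_mul]
  rw [← integral_finsetSum _ fun k _ => ((hf k).integrableOn_unitCube.const_mul _)]
  exact integral_mono hΦ.integrableOn_unitCube
    (Continuous.integrableOn_unitCube (by fun_prop)) h

theorem neg_two_mul_mul_le {a A : ℝ} (ha : a ^ 2 ≤ A) (w q : ℝ) :
    -(2 * w * (a * q)) ≤ w ^ 2 + A * q ^ 2 := by
  nlinarith [sq_nonneg (w + a * q), mul_le_mul_of_nonneg_right ha (sq_nonneg q)]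

theorem two_mul_mul_le {a A : ℝ} (ha : a ^ 2 ≤ A) (w q : ℝ) :
    2 * w * (a * q) ≤ w ^ 2 + A * q ^ 2 := by
  nlinarith [sq_nonneg (w - a * q), mul_le_mul_of_nonneg_right ha (sq_nonneg q)]

theorem neg_two_mul_Omg_le {a u : V3 → V3} {A : ℝ} (hA : 0 ≤ A) {x : V3}
    (ha : ∀ k j, (pd k (fun y => a y j) x) ^ 2 ≤ A) (c : ℝ) (i : Fin 3) :
    -(2 * c * Omg a u x i) ≤ 6 * c ^ 2 + A * ∑ i, ∑ j, (pd j (fun y => u y i) x) ^ 2 := by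
  have h1 := fun k j l => neg_two_mul_mul_le (ha k j) c (pd j (fun y => u y l) x)
  have h2 := fun k j l => two_mul_mul_le (ha k j) c (pd j (fun y => u y l) x)
  have h3 := fun j l => mul_nonneg hA (sq_nonneg (pd j (fun y => u y l) x))
  fin_cases i <;> simp only [Omg, Fin.sum_univ_three, Fin.zero_eta, Fin.mk_one, Fin.reduceFinMk,
    Matrix.cons_val]
  · linarith [h1 1 0 2, h1 1 1 2, h1 1 2 2, h2 2 0 1, h2 2 1 1, h2 2 2 1, h3 0 0, h3 1 0, h3 2 0]
  · linarith [h1 2 0 0, h1 2 1 0, h1 2 2 0, h2 0 0 2, h2 0 1 2, h2 0 2 2, h3 0 1, h3 1 1, h3 2 1]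
  · linarith [h1 0 0 1, h1 0 1 1, h1 0 2 1, h2 1 0 0, h2 1 1 0, h2 1 2 0, h3 0 2, h3 1 2, h3 2 2]

theorem sum_curl3_sq_le (w : V3 → V3) (x : V3) :
    ∑ i, (curl3 w x i) ^ 2 ≤ 2 * ∑ i, ∑ j, (pd j (fun y => w y i) x) ^ 2 := by
  simp only [curl3, Fin.sum_univ_three, Matrix.cons_val]
  nlinarith [sq_nonneg (pd 1 (fun y => w y 2) x + pd 2 (fun y => w y 1) x),
    sq_nonneg (pd 2 (fun y => w y 0) x + pd 0 (fun y => w y 2) x),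
    sq_nonneg (pd 0 (fun y => w y 1) x + pd 1 (fun y => w y 0) x),
    sq_nonneg (pd 0 (fun y => w y 0) x), sq_nonneg (pd 1 (fun y => w y 1) x),
    sq_nonneg (pd 2 (fun y => w y 2) x)]

theorem volume_real_unitCube : ∫ _ in Set.Icc (0:V3) 1, (1:ℝ) = 1 := by
  simp [Measure.real, Real.volume_Icc_pi]

theorem vorticity_energy_bound {α β A B H : ℝ} (hα : 0 < α) (hA : 0 ≤ A)
    (hB : 0 ≤ B) {w om u v a b p h d : V3 → V3}
    (hw : ∀ i, SmoothPeriodic (fun x => w x i)) (hom : ∀ i, SmoothPeriodic (fun x => om x i))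
    (hu : ∀ i, SmoothPeriodic (fun x => u x i)) (hv : ∀ i, SmoothPeriodic (fun x => v x i))
    (hb : ∀ i, SmoothPeriodic (fun x => b x i)) (hh : ∀ i, SmoothPeriodic (fun x => h x i))
    (hd : ∀ i, Continuous (fun x => d x i))
    (hdiv : ∀ x, ∑ j, pd j (fun y => b y j) x = 0)
    (hdw : ∀ x i, d x i = α * lap (fun y => w y i) x - (∑ j, b x j * pd j (fun y => w y i) x)
      - (∑ j, a x j * pd j (fun y => om y i) x) - Omg a u x i - Omg p v x i + β * curl3 h x i)
    (ha : ∀ x j, (a x j) ^ 2 ≤ A) (hda : ∀ x k j, (pd k (fun y => a y j) x) ^ 2 ≤ A)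
    (hdp : ∀ x k j, (pd k (fun y => p y j) x) ^ 2 ≤ B) (hH : ∀ x i, (h x i) ^ 2 ≤ H) :
    ∫ x in Set.Icc (0:V3) 1, ∑ i, 2 * w x i * d x i
      ≤ 15 * (∫ x in Set.Icc (0:V3) 1, ∑ i, (w x i) ^ 2)
        + A * (∫ x in Set.Icc (0:V3) 1, ∑ i, ∑ j, (pd j (fun y => om y i) x) ^ 2)
        + 3 * A * (∫ x in Set.Icc (0:V3) 1, ∑ i, ∑ j, (pd j (fun y => u y i) x) ^ 2)
        + 3 * B * (∫ x in Set.Icc (0:V3) 1, ∑ i, ∑ j, (pd j (fun y => v y i) x) ^ 2)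
        + 3 * (β ^ 2 / α * H) := by
  have cw := fun i => (hw i).continuous
  have cb := fun i => (hb i).continuous
  have ch := fun i => (hh i).continuous
  have cdw := fun i j => ((hw i).pd j).continuous
  have cdom := fun i j => ((hom i).pd j).continuous
  have cdu := fun i j => ((hu i).pd j).continuous
  have cdv := fun i j => ((hv i).pd j).continuous
  have cddw := fun i j => (((hw i).pd j).pd j).continuous
  have ccw : ∀ i, Continuous (fun x => curl3 w x i) := fun i => by
    fin_cases i <;> simp only [curl3, Fin.zero_eta, Fin.mk_one, Fin.reduceFinMk, Matrix.cons_val] <;>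
      exact (cdw _ _).sub (cdw _ _)
  have cch : ∀ i, Continuous (fun x => curl3 h x i) := fun i => by
    have cdh := fun i j => ((hh i).pd j).continuous
    fin_cases i <;> simp only [curl3, Fin.zero_eta, Fin.mk_one, Fin.reduceFinMk, Matrix.cons_val] <;>
      exact (cdh _ _).sub (cdh _ _)
  have clap : ∀ i, Continuous (lap (fun y => w y i)) := fun i =>
    continuous_finsetSum _ fun j _ => cddw i j
  have z1 : ∫ x in Set.Icc (0:V3) 1, ∑ i, (w x i * lap (fun y => w y i) x
      + ∑ j, (pd j (fun y => w y i) x) ^ 2) = 0 := by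
    rw [integral_finsetSum _ fun i _ => Continuous.integrableOn_unitCube (by fun_prop)]
    exact Finset.sum_eq_zero fun i _ => integral_mul_lap_add_eq_zero (hw i)
  have z2 : ∫ x in Set.Icc (0:V3) 1, ∑ i, (w x i * ∑ j, b x j * pd j (fun y => w y i) x) = 0 := by
    rw [integral_finsetSum _ fun i _ => Continuous.integrableOn_unitCube (by fun_prop)]
    exact Finset.sum_eq_zero fun i _ => integral_mul_transport_eq_zero hb hdiv (hw i)
  have z3 := integral_dot_curl_sub_eq_zero hw hh
  have main := integral_le_of_le_linear_combination
    (Φ := fun x => ∑ i, 2 * w x i * d x i) (by fun_prop)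
    (c := ![15, A, 3 * A, 3 * B, 3 * (β ^ 2 / α * H), 2 * α, -2, 2 * β])
    (f := ![fun x => ∑ i, (w x i) ^ 2, fun x => ∑ i, ∑ j, (pd j (fun y => om y i) x) ^ 2,
      fun x => ∑ i, ∑ j, (pd j (fun y => u y i) x) ^ 2,
      fun x => ∑ i, ∑ j, (pd j (fun y => v y i) x) ^ 2, fun _ => 1,
      fun x => ∑ i, (w x i * lap (fun y => w y i) x + ∑ j, (pd j (fun y => w y i) x) ^ 2),
      fun x => ∑ i, (w x i * ∑ j, b x j * pd j (fun y => w y i) x),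
      fun x => (∑ i, w x i * curl3 h x i) - ∑ i, curl3 w x i * h x i])
    (by
      simp only [Fin.forall_fin_succ, Matrix.cons_val_zero, Matrix.cons_val_succ, IsEmpty.forall_iff,
        and_true]
      refine ⟨?_, ?_, ?_, ?_, ?_, ?_, ?_, ?_⟩ <;> fun_prop)
    (fun x => by
      simp only [Fin.sum_univ_eight, Matrix.cons_val]
      have e1 : ∀ i, 2 * w x i * d x i ≤ 15 * (w x i) ^ 2
          + A * (∑ j, (pd j (fun y => om y i) x) ^ 2)
          + A * (∑ i, ∑ j, (pd j (fun y => u y i) x) ^ 2)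
          + B * (∑ i, ∑ j, (pd j (fun y => v y i) x) ^ 2)
          + 2 * α * (w x i * lap (fun y => w y i) x)
          - 2 * (w x i * ∑ j, b x j * pd j (fun y => w y i) x)
          + 2 * β * (w x i * curl3 h x i) := fun i => by
        have t1 := neg_two_mul_Omg_le (u := u) hA (hda x) (w x i) i
        have t2 := neg_two_mul_Omg_le (u := v) hB (hdp x) (w x i) i
        have t3 := fun j => neg_two_mul_mul_le (ha x j) (w x i) (pd j (fun y => om y i) x)
        have t30 := t3 0
        have t31 := t3 1
        have t32 := t3 2
        rw [hdw]
        have t4 : -(2 * w x i * ∑ j, a x j * pd j (fun y => om y i) x)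
            ≤ 3 * (w x i) ^ 2 + A * (∑ j, (pd j (fun y => om y i) x) ^ 2) := by
          simp only [Fin.sum_univ_three]
          linarith
        linarith
      have e2 := sum_curl3_sq_le w x
      have e3 : ∀ i, 2 * β * (curl3 w x i * h x i)
          ≤ α * (curl3 w x i) ^ 2 + β ^ 2 / α * H := fun i => by
        have h1 : 0 ≤ (α * curl3 w x i - β * h x i) ^ 2 / α := by positivity
        have h2 : (α * curl3 w x i - β * h x i) ^ 2 / α = α * (curl3 w x i) ^ 2
          - 2 * β * (curl3 w x i * h x i) + β ^ 2 / α * (h x i) ^ 2 := by field_simp; ring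
        have h3 : β ^ 2 / α * (h x i) ^ 2 ≤ β ^ 2 / α * H :=
          mul_le_mul_of_nonneg_left (hH x i) (by positivity)
        linarith
      have e4 := mul_le_mul_of_nonneg_left e2 hα.le
      have e10 := e1 0
      have e11 := e1 1
      have e12 := e1 2
      have e30 := e3 0
      have e31 := e3 1
      have e32 := e3 2
      simp only [Fin.sum_univ_three] at e10 e11 e12 e4 ⊢
      linarith)
  simp only [Fin.sum_univ_eight, Matrix.cons_val] at main
  rw [z1, z2, z3, volume_real_unitCube] at main
  linarith

theorem stress_energy_bound {ε γ A B : ℝ} (hε : 0 ≤ ε) (hγ : 0 < γ)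
    {a b : V3 → V3} {s σ d : V3 → Matrix (Fin 3) (Fin 3) ℝ}
    (hs : ∀ i j, SmoothPeriodic (fun x => s x i j)) (hσ : ∀ i j, SmoothPeriodic (fun x => σ x i j))
    (hb : ∀ i, SmoothPeriodic (fun x => b x i)) (hd : ∀ i j, Continuous (fun x => d x i j))
    (hdiv : ∀ x, ∑ j, pd j (fun y => b y j) x = 0)
    (hds : ∀ x i j, d x i j = ε * lap (fun y => s y i j) x
      - (∑ k, b x k * pd k (fun y => s y i j) x) - (∑ k, a x k * pd k (fun y => σ y i j) x)
      + (∑ k, pd k (fun y => b y i) x * s x k j) + (∑ k, pd k (fun y => a y i) x * σ x k j)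
      + (∑ k, s x i k * pd k (fun y => b y j) x) + (∑ k, σ x i k * pd k (fun y => a y j) x)
      - γ * s x i j)
    (ha : ∀ x j, (a x j) ^ 2 ≤ A) (hda : ∀ x k j, (pd k (fun y => a y j) x) ^ 2 ≤ A)
    (hdb : ∀ x k j, (pd k (fun y => b y j) x) ^ 2 ≤ B) :
    ∫ x in Set.Icc (0:V3) 1, ∑ i, ∑ j, 2 * s x i j * d x i j
      ≤ (15 + 6 * B) * (∫ x in Set.Icc (0:V3) 1, ∑ i, ∑ j, (s x i j) ^ 2)
        + 6 * A * (∫ x in Set.Icc (0:V3) 1, ∑ i, ∑ j, (σ x i j) ^ 2)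
        + A * (∫ x in Set.Icc (0:V3) 1, ∑ i, ∑ j, ∑ k, (pd k (fun y => σ y i j) x) ^ 2) := by
  have cs := fun i j => (hs i j).continuous
  have cσ := fun i j => (hσ i j).continuous
  have cb := fun i => (hb i).continuous
  have cds := fun i j k => ((hs i j).pd k).continuous
  have cdσ := fun i j k => ((hσ i j).pd k).continuous
  have clap : ∀ i j, Continuous (lap (fun y => s y i j)) := fun i j =>
    continuous_finsetSum _ fun k _ => (((hs i j).pd k).pd k).continuous
  have z1 : ∫ x in Set.Icc (0:V3) 1, ∑ i, ∑ j, (s x i j * lap (fun y => s y i j) x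
      + ∑ k, (pd k (fun y => s y i j) x) ^ 2) = 0 := by
    rw [integral_finsetSum _ fun i _ => Continuous.integrableOn_unitCube (by fun_prop)]
    refine Finset.sum_eq_zero fun i _ => ?_
    rw [integral_finsetSum _ fun i _ => Continuous.integrableOn_unitCube (by fun_prop)]
    exact Finset.sum_eq_zero fun j _ => integral_mul_lap_add_eq_zero (hs i j)
  have z2 : ∫ x in Set.Icc (0:V3) 1,
      ∑ i, ∑ j, (s x i j * ∑ k, b x k * pd k (fun y => s y i j) x) = 0 := by
    rw [integral_finsetSum _ fun i _ => Continuous.integrableOn_unitCube (by fun_prop)]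
    refine Finset.sum_eq_zero fun i _ => ?_
    rw [integral_finsetSum _ fun i _ => Continuous.integrableOn_unitCube (by fun_prop)]
    exact Finset.sum_eq_zero fun j _ => integral_mul_transport_eq_zero hb hdiv (hs i j)
  have pw : ∀ x i j, 2 * s x i j * d x i j ≤ 15 * (s x i j) ^ 2
      + A * (∑ k, (pd k (fun y => σ y i j) x) ^ 2)
      + B * (∑ k, (s x k j) ^ 2) + B * (∑ k, (s x i k) ^ 2)
      + A * (∑ k, (σ x k j) ^ 2) + A * (∑ k, (σ x i k) ^ 2)
      + 2 * ε * (s x i j * lap (fun y => s y i j) x + ∑ k, (pd k (fun y => s y i j) x) ^ 2)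
      - 2 * (s x i j * ∑ k, b x k * pd k (fun y => s y i j) x) := fun x i j => by
    have t1 := fun k => neg_two_mul_mul_le (ha x k) (s x i j) (pd k (fun y => σ y i j) x)
    have t2 := fun k => two_mul_mul_le (hdb x k i) (s x i j) (s x k j)
    have t3 := fun k => two_mul_mul_le (hdb x k j) (s x i j) (s x i k)
    have t4 := fun k => two_mul_mul_le (hda x k i) (s x i j) (σ x k j)
    have t5 := fun k => two_mul_mul_le (hda x k j) (s x i j) (σ x i k)
    have t6 : 0 ≤ γ * (s x i j) ^ 2 := by positivity
    have t7 : 0 ≤ ε * ∑ k, (pd k (fun y => s y i j) x) ^ 2 :=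
      mul_nonneg hε (Finset.sum_nonneg fun k _ => sq_nonneg _)
    rw [hds]
    simp only [Fin.sum_univ_three] at t7 ⊢
    linarith [t1 0, t1 1, t1 2, t2 0, t2 1, t2 2, t3 0, t3 1, t3 2, t4 0, t4 1, t4 2,
      t5 0, t5 1, t5 2]
  have row : ∀ f : Fin 3 → Fin 3 → ℝ, ∑ i, ∑ _j : Fin 3, ∑ k, f i k = 3 * ∑ i, ∑ j, f i j := fun f => by
    simp only [Fin.sum_univ_three]; ring
  have col : ∀ f : Fin 3 → Fin 3 → ℝ, ∑ _i : Fin 3, ∑ j, ∑ k, f k j = 3 * ∑ i, ∑ j, f i j :=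
    fun f => by simp only [Fin.sum_univ_three]; ring
  have main := integral_le_of_le_linear_combination
    (Φ := fun x => ∑ i, ∑ j, 2 * s x i j * d x i j) (by fun_prop)
    (c := ![15 + 6 * B, 6 * A, A, 2 * ε, -2])
    (f := ![fun x => ∑ i, ∑ j, (s x i j) ^ 2, fun x => ∑ i, ∑ j, (σ x i j) ^ 2,
      fun x => ∑ i, ∑ j, ∑ k, (pd k (fun y => σ y i j) x) ^ 2,
      fun x => ∑ i, ∑ j, (s x i j * lap (fun y => s y i j) x
        + ∑ k, (pd k (fun y => s y i j) x) ^ 2),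
      fun x => ∑ i, ∑ j, (s x i j * ∑ k, b x k * pd k (fun y => s y i j) x)])
    (by
      simp only [Fin.forall_fin_succ, Matrix.cons_val_zero, Matrix.cons_val_succ, IsEmpty.forall_iff,
        and_true]
      refine ⟨?_, ?_, ?_, ?_, ?_⟩ <;> fun_prop)
    (fun x => by
      simp only [Fin.sum_univ_five, Matrix.cons_val]
      refine (Finset.sum_le_sum fun i _ => Finset.sum_le_sum fun j _ => pw x i j).trans (le_of_eq ?_)
      simp only [Finset.sum_add_distrib, Finset.sum_sub_distrib, ← Finset.mul_sum]
      rw [row fun i k => (s x i k) ^ 2, row fun i k => (σ x i k) ^ 2,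
        col fun i k => (s x i k) ^ 2, col fun i k => (σ x i k) ^ 2]
      ring)
  simp only [Fin.sum_univ_five, Matrix.cons_val] at main
  rw [z1, z2] at main
  linarith

section TimeDerivative

theorem hasDerivAt_snd {g : V3 → ℝ → ℝ} (hg : ContDiff ℝ 1 (fun q : V3 × ℝ => g q.1 q.2))
    (x : V3) (t : ℝ) :
    HasDerivAt (g x) (fderiv ℝ (fun q : V3 × ℝ => g q.1 q.2) (x, t) (0, 1)) t := by
  have h := ((hg.differentiable one_ne_zero) (x, t)).hasFDerivAt
  exact h.comp_hasDerivAt t ((hasDerivAt_const t x).prodMk (hasDerivAt_id t))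

theorem continuous_deriv_snd {g : V3 → ℝ → ℝ}
    (hg : ContDiff ℝ 1 (fun q : V3 × ℝ => g q.1 q.2)) :
    Continuous (fun q : V3 × ℝ => deriv (g q.1) q.2) := by
  have : (fun q : V3 × ℝ => deriv (g q.1) q.2)
      = fun q => fderiv ℝ (fun q : V3 × ℝ => g q.1 q.2) q (0, 1) :=
    funext fun q => (hasDerivAt_snd hg q.1 q.2).deriv
  rw [this]
  exact (hg.continuous_fderiv one_ne_zero).clm_apply continuous_const

theorem hasDerivAt_integral_unitCube {g : V3 → ℝ → ℝ}
    (hg : ContDiff ℝ 1 (fun q : V3 × ℝ => g q.1 q.2)) (t : ℝ) :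
    HasDerivAt (fun s => ∫ x in Set.Icc (0:V3) 1, g x s)
      (∫ x in Set.Icc (0:V3) 1, deriv (g x) t) t := by
  have hc := continuous_deriv_snd hg
  obtain ⟨R, hR⟩ := ((isCompact_Icc (a := (0:V3)) (b := 1)).prod
    (isCompact_Icc (a := t - 1) (b := t + 1))).exists_bound_of_continuousOn hc.continuousOn
  refine (hasDerivAt_integral_of_dominated_loc_of_deriv_le (F := fun s x => g x s)
    (F' := fun s x => deriv (g x) s) (bound := fun _ => R) (s := Set.Icc (t - 1) (t + 1))
    (Icc_mem_nhds (by linarith) (by linarith))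
    (Filter.Eventually.of_forall fun s => ?_) ?_ ?_ ?_ ?_ ?_).2
  · exact (hg.continuous.comp (Continuous.prodMk_left s)).aestronglyMeasurable
  · exact (hg.continuous.comp (Continuous.prodMk_left t)).integrableOn_unitCube
  · exact (hc.comp (Continuous.prodMk_left t)).aestronglyMeasurable
  · exact (ae_restrict_iff' measurableSet_Icc).2
      (Filter.Eventually.of_forall fun x hx s hs => hR (x, s) ⟨hx, hs⟩)
  · exact continuous_const.integrableOn_unitCube
  · exact Filter.Eventually.of_forall fun x s _ =>
      (hasDerivAt_snd hg x s).differentiableAt.hasDerivAt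

theorem le_exp_mul_of_hasDerivAt_le {E E' : ℝ → ℝ} {C T : ℝ} (hE : ∀ t, HasDerivAt E (E' t) t)
    (hb : ∀ t ∈ Set.Icc (0:ℝ) T, E' t ≤ C * E t) {t : ℝ} (ht : t ∈ Set.Icc (0:ℝ) T) :
    E t ≤ Real.exp (C * t) * E 0 := by
  have h := le_gronwallBound_of_liminf_deriv_right_le (f := E) (f' := E') (δ := E 0) (K := C)
    (ε := 0) (a := 0) (b := T) (fun s _ => (hE s).continuousAt.continuousWithinAt)
    (fun s _ r hr => by
      simpa [slope] using (hE s).hasDerivWithinAt.liminf_right_slope_le hr)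
    le_rfl (fun s hs => by simpa using hb s ⟨hs.1, hs.2.le⟩) t ht
  rw [gronwallBound_ε0, sub_zero, mul_comm] at h
  exact h

end TimeDerivative

theorem SmoothPeriodic.of_slice {f : V3 → ℝ → ℝ}
    (hf : ContDiff ℝ (⊤:ℕ∞) (fun q : V3 × ℝ => f q.1 q.2)) {t : ℝ}
    (hp : Periodic3 (fun x => f x t)) : SmoothPeriodic (fun x => f x t) :=
  ⟨hf.comp (contDiff_prodMk_left t), hp⟩

theorem lap_sub {f g : V3 → ℝ} (hf : SmoothPeriodic f) (hg : SmoothPeriodic g) (x : V3) :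
    lap (fun y => f y - g y) x = lap f x - lap g x := by
  unfold lap
  rw [← Finset.sum_sub_distrib]
  refine Finset.sum_congr rfl fun i _ => ?_
  rw [← pd_sub (hf.pd i) (hg.pd i)]
  congr 1
  exact funext fun y => pd_sub hf hg i y

theorem curl3_sub {h k : V3 → V3} (hh : ∀ i, SmoothPeriodic (fun x => h x i))
    (hk : ∀ i, SmoothPeriodic (fun x => k x i)) (x : V3) (i : Fin 3) :
    curl3 (fun y j => h y j - k y j) x i = curl3 h x i - curl3 k x i := by
  fin_cases i <;>
  · simp only [curl3, Fin.zero_eta, Fin.mk_one, Fin.reduceFinMk, Matrix.cons_val,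
      pd_sub (hh _) (hk _)]
    ring

theorem Omg_sub_Omg {b p u v : V3 → V3} (hb : ∀ i, SmoothPeriodic (fun x => b x i))
    (hp : ∀ i, SmoothPeriodic (fun x => p x i)) (hu : ∀ i, SmoothPeriodic (fun x => u x i))
    (hv : ∀ i, SmoothPeriodic (fun x => v x i)) (x : V3) (i : Fin 3) :
    Omg b u x i - Omg p v x i
      = Omg (fun y j => b y j - p y j) u x i + Omg p (fun y j => u y j - v y j) x i := by
  fin_cases i <;>
  · simp only [Omg, Fin.zero_eta, Fin.mk_one, Fin.reduceFinMk, Matrix.cons_val,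
      pd_sub (hb _) (hp _), pd_sub (hu _) (hv _), Fin.sum_univ_three]
    ring

theorem sq_J3_le_and_sq_pd_J3_le {η : V3 → ℝ} {K : ℝ}
    (hJ : ∀ f : V3 → ℝ, Continuous f → Periodic3 f → ∀ x : V3,
      |J3 η f x| + Real.sqrt (∑ i, (pd i (J3 η f) x) ^ 2)
        ≤ K * Real.sqrt (∫ y in Set.Icc (0:V3) 1, (f y) ^ 2))
    {f : V3 → ℝ} (hf : SmoothPeriodic f) (x : V3) :
    (J3 η f x) ^ 2 ≤ K ^ 2 * (∫ y in Set.Icc (0:V3) 1, (f y) ^ 2) ∧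
      ∀ k, (pd k (J3 η f) x) ^ 2 ≤ K ^ 2 * ∫ y in Set.Icc (0:V3) 1, (f y) ^ 2 := by
  have h := hJ f hf.continuous hf.2 x
  have h0 : 0 ≤ ∫ y in Set.Icc (0:V3) 1, (f y) ^ 2 := integral_nonneg fun y => sq_nonneg _
  have e : K ^ 2 * (∫ y in Set.Icc (0:V3) 1, (f y) ^ 2)
      = (K * Real.sqrt (∫ y in Set.Icc (0:V3) 1, (f y) ^ 2)) ^ 2 := by
    rw [mul_pow, Real.sq_sqrt h0]
  rw [e]
  refine ⟨?_, fun k => ?_⟩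
  · exact sq_le_sq' (by
      linarith [neg_abs_le (J3 η f x), Real.sqrt_nonneg (∑ i, (pd i (J3 η f) x) ^ 2)])
      (by linarith [le_abs_self (J3 η f x), Real.sqrt_nonneg (∑ i, (pd i (J3 η f) x) ^ 2)])
  · have h1 : |pd k (J3 η f) x| ≤ Real.sqrt (∑ i, (pd i (J3 η f) x) ^ 2) := by
      rw [← Real.sqrt_sq_eq_abs]
      exact Real.sqrt_le_sqrt (Finset.single_le_sum (f := fun i => (pd i (J3 η f) x) ^ 2)
        (fun i _ => sq_nonneg _) (Finset.mem_univ k))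
    have h2 := abs_nonneg (J3 η f x)
    exact sq_le_sq' (by linarith [neg_abs_le (pd k (J3 η f) x)])
      (by linarith [le_abs_self (pd k (J3 η f) x)])

theorem integral_sq_le_integral_sum_sq {ι : Type*} [Fintype ι] {f : ι → V3 → ℝ}
    (hf : ∀ i, Continuous (f i)) (i : ι) :
    ∫ x in Set.Icc (0:V3) 1, (f i x) ^ 2 ≤ ∫ x in Set.Icc (0:V3) 1, ∑ i, (f i x) ^ 2 :=
  integral_mono (Continuous.integrableOn_unitCube (by fun_prop))
    (Continuous.integrableOn_unitCube (by fun_prop)) fun x =>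
      Finset.single_le_sum (f := fun i => (f i x) ^ 2) (fun i _ => sq_nonneg _) (Finset.mem_univ i)

theorem integral_sq_le_integral_sum_sum_sq {ι κ : Type*} [Fintype ι] [Fintype κ]
    {f : ι → κ → V3 → ℝ} (hf : ∀ i j, Continuous (f i j)) (i : ι) (j : κ) :
    ∫ x in Set.Icc (0:V3) 1, (f i j x) ^ 2 ≤ ∫ x in Set.Icc (0:V3) 1, ∑ i, ∑ j, (f i j x) ^ 2 := by
  simpa only [Fintype.sum_prod_type] using
    integral_sq_le_integral_sum_sq (f := fun p : ι × κ => f p.1 p.2) (fun p => hf p.1 p.2) (i, j)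

section Mollified

variable {η : V3 → ℝ} {K : ℝ}

theorem sum_pd_J3_eq_zero (hη : ContDiff ℝ (⊤:ℕ∞) η) (hc : HasCompactSupport η) {u : V3 → V3}
    (hu : ∀ i, SmoothPeriodic (fun x => u x i))
    (hdiv : ∀ x, ∑ j, pd j (fun y => u y j) x = 0) (x : V3) :
    ∑ j, pd j (J3 η (fun y => u y j)) x = 0 := by
  simp only [fun j => pd_J3 hη hc (hu j) j x]
  rw [← J3_sum hη.continuous hc fun j => ((hu j).pd j).continuous]
  simp [hdiv, J3]

/-- The mollified gradient of a divergence-free field is controlled by the `L²` norm of its curl. -/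
theorem sq_pd_J3_le_of_curl (hη : ContDiff ℝ (⊤:ℕ∞) η) (hc : HasCompactSupport η)
    (hJ : ∀ f : V3 → ℝ, Continuous f → Periodic3 f → ∀ x : V3,
      |J3 η f x| + Real.sqrt (∑ i, (pd i (J3 η f) x) ^ 2)
        ≤ K * Real.sqrt (∫ y in Set.Icc (0:V3) 1, (f y) ^ 2))
    {u : V3 → V3} (hu : ∀ i, SmoothPeriodic (fun x => u x i))
    (hdiv : ∀ x, ∑ j, pd j (fun y => u y j) x = 0) (x : V3) (k j : Fin 3) :
    (pd k (J3 η (fun y => u y j)) x) ^ 2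
      ≤ K ^ 2 * ∫ x in Set.Icc (0:V3) 1, ∑ i, (curl3 u x i) ^ 2 := by
  rw [pd_J3 hη hc (hu j), ← integral_grad_sq_eq_integral_curl_sq hu hdiv]
  refine (sq_J3_le_and_sq_pd_J3_le hJ ((hu j).pd k) x).1.trans ?_
  exact mul_le_mul_of_nonneg_left (integral_sq_le_integral_sum_sum_sq
    (f := fun i j => pd j (fun y => u y i)) (fun i j => ((hu i).pd j).continuous) j k) (sq_nonneg _)

end Mollified

/-- L² stability of solutions of the regularized vorticity system.
The constant C depends only on α, β, γ, K, M, C̃. -/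
theorem L2_stability (α β γ K M Ct : ℝ)
    (hα : 0 < α) (hβ : 0 < β) (hγ : 0 < γ) (hK : 0 < K) (hM : 0 < M) (hCt : 0 < Ct) :
    ∃ C : ℝ, ∀ (ε δ T : ℝ), 0 ≤ ε → 0 ≤ δ → 0 < T →
    ∀ (η : V3 → ℝ), ContDiff ℝ (⊤:ℕ∞) η → HasCompactSupport η →
      (∀ x : V3, η (-x) = η x) → (∫ x : V3, η x) = 1 →
    ∀ (g u₁ ω₁ u₂ ω₂ : V3 → ℝ → V3)
      (σ₁ σ₂ : V3 → ℝ → Matrix (Fin 3) (Fin 3) ℝ),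
      IsVortSolution η α β γ δ ε T g u₁ ω₁ σ₁ →
      IsVortSolution η α β γ δ ε T g u₂ ω₂ σ₂ →
      -- (i): mollification bound
      (∀ f : V3 → ℝ, Continuous f → Periodic3 f → ∀ x : V3,
        |J3 η f x| + Real.sqrt (∑ i, (pd i (J3 η f) x)^2)
          ≤ K * Real.sqrt (∫ y in Set.Icc (0:V3) 1, (f y)^2)) →
      -- (ii): recovery of velocity from vorticity
      (∀ t ∈ Set.Icc (0:ℝ) T,
        (∫ x in Set.Icc (0:V3) 1, ∑ i, (u₂ x t i - u₁ x t i)^2)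
          + (∫ x in Set.Icc (0:V3) 1, ∑ i, ∑ j,
              (pd j (fun y => u₂ y t i - u₁ y t i) x)^2)
        ≤ Ct * ∫ x in Set.Icc (0:V3) 1, ∑ i, (ω₂ x t i - ω₁ x t i)^2) →
      -- (iii): a priori bounds
      (∀ t ∈ Set.Icc (0:ℝ) T,
        Real.sqrt (∫ x in Set.Icc (0:V3) 1, ∑ i, (ω₁ x t i)^2) ≤ M ∧
        Real.sqrt (∫ x in Set.Icc (0:V3) 1, ∑ i, (ω₂ x t i)^2) ≤ M ∧
        Real.sqrt (∫ x in Set.Icc (0:V3) 1, ∑ i, ∑ j, (pd j (fun y => ω₁ y t i) x)^2) ≤ M ∧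
        Real.sqrt (∫ x in Set.Icc (0:V3) 1, ∑ i, ∑ j, (σ₁ x t i j)^2) ≤ M ∧
        Real.sqrt (∫ x in Set.Icc (0:V3) 1, ∑ i, ∑ j, ∑ k,
          (pd k (fun y => σ₁ y t i j) x)^2) ≤ M) →
      ∀ t ∈ Set.Icc (0:ℝ) T,
        (∫ x in Set.Icc (0:V3) 1, ∑ i, (ω₂ x t i - ω₁ x t i)^2)
          + (∫ x in Set.Icc (0:V3) 1, ∑ i, ∑ j, (σ₂ x t i j - σ₁ x t i j)^2)
        ≤ Real.exp (C * t)
          * ((∫ x in Set.Icc (0:V3) 1, ∑ i, (ω₂ x 0 i - ω₁ x 0 i)^2)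
             + ∫ x in Set.Icc (0:V3) 1, ∑ i, ∑ j, (σ₂ x 0 i j - σ₁ x 0 i j)^2) := by
  refine ⟨15 + 14 * K ^ 2 * M ^ 2 * Ct + 27 * β ^ 2 / α * K ^ 2 + 6 * K ^ 2 * M ^ 2, ?_⟩
  intro ε δ T hε _ hT η hη hc _ _ g u₁ ω₁ u₂ ω₂ σ₁ σ₂ sol₁ sol₂ hJ hrec hbd τ hτ
  obtain ⟨su₁, sω₁, sσ₁, pu₁, pω₁, pσ₁, curl₁, div₁, eω₁, eσ₁⟩ := sol₁
  obtain ⟨su₂, sω₂, sσ₂, pu₂, pω₂, pσ₂, curl₂, div₂, eω₂, eσ₂⟩ := sol₂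
  have sw : ∀ i, ContDiff ℝ 1 (fun q : V3 × ℝ => ω₂ q.1 q.2 i - ω₁ q.1 q.2 i) := fun i =>
    ((sω₂ i).sub (sω₁ i)).of_le (by simp)
  have ss : ∀ i j, ContDiff ℝ 1 (fun q : V3 × ℝ => σ₂ q.1 q.2 i j - σ₁ q.1 q.2 i j) := fun i j =>
    ((sσ₂ i j).sub (sσ₁ i j)).of_le (by simp)
  have sW : ContDiff ℝ 1 (fun q : V3 × ℝ => ∑ i, (ω₂ q.1 q.2 i - ω₁ q.1 q.2 i) ^ 2) :=
    ContDiff.sum fun i _ => (sw i).pow 2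
  have sS : ContDiff ℝ 1 (fun q : V3 × ℝ => ∑ i, ∑ j, (σ₂ q.1 q.2 i j - σ₁ q.1 q.2 i j) ^ 2) :=
    ContDiff.sum fun i _ => ContDiff.sum fun j _ => (ss i j).pow 2
  refine le_exp_mul_of_hasDerivAt_le (fun t =>
    (hasDerivAt_integral_unitCube (g := fun x t => ∑ i, (ω₂ x t i - ω₁ x t i) ^ 2) sW t).add
    (hasDerivAt_integral_unitCube
      (g := fun x t => ∑ i, ∑ j, (σ₂ x t i j - σ₁ x t i j) ^ 2) sS t)) (fun t ht => ?_) hτ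
  have dw : ∀ x i, HasDerivAt (fun s => ω₂ x s i - ω₁ x s i)
      (deriv (fun s => ω₂ x s i - ω₁ x s i) t) t := fun x i =>
    (hasDerivAt_snd (g := fun x s => ω₂ x s i - ω₁ x s i) (sw i) x t).differentiableAt.hasDerivAt
  have ds : ∀ x i j, HasDerivAt (fun s => σ₂ x s i j - σ₁ x s i j)
      (deriv (fun s => σ₂ x s i j - σ₁ x s i j) t) t := fun x i j =>
    (hasDerivAt_snd (g := fun x s => σ₂ x s i j - σ₁ x s i j) (ss i j) x
      t).differentiableAt.hasDerivAt
  have eW : ∀ x, deriv (fun t => ∑ i, (ω₂ x t i - ω₁ x t i) ^ 2) t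
      = ∑ i, 2 * (ω₂ x t i - ω₁ x t i) * deriv (fun s => ω₂ x s i - ω₁ x s i) t := fun x => by
    rw [(HasDerivAt.fun_sum fun i _ => (dw x i).fun_pow 2).deriv]
    simp
  have eS : ∀ x, deriv (fun t => ∑ i, ∑ j, (σ₂ x t i j - σ₁ x t i j) ^ 2) t
      = ∑ i, ∑ j, 2 * (σ₂ x t i j - σ₁ x t i j)
        * deriv (fun s => σ₂ x s i j - σ₁ x s i j) t := fun x => by
    rw [(HasDerivAt.fun_sum fun i _ => HasDerivAt.fun_sum fun j _ => (ds x i j).fun_pow 2).deriv]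
    simp
  simp only [eW, eS]
  have hu₁ : ∀ i, SmoothPeriodic (fun x => u₁ x t i) := fun i =>
    SmoothPeriodic.of_slice (f := fun x t => u₁ x t i) (su₁ i) (pu₁ t i)
  have hu₂ : ∀ i, SmoothPeriodic (fun x => u₂ x t i) := fun i =>
    SmoothPeriodic.of_slice (f := fun x t => u₂ x t i) (su₂ i) (pu₂ t i)
  have hω₁ : ∀ i, SmoothPeriodic (fun x => ω₁ x t i) := fun i =>
    SmoothPeriodic.of_slice (f := fun x t => ω₁ x t i) (sω₁ i) (pω₁ t i)
  have hω₂ : ∀ i, SmoothPeriodic (fun x => ω₂ x t i) := fun i =>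
    SmoothPeriodic.of_slice (f := fun x t => ω₂ x t i) (sω₂ i) (pω₂ t i)
  have hσ₁ : ∀ i j, SmoothPeriodic (fun x => σ₁ x t i j) := fun i j =>
    SmoothPeriodic.of_slice (f := fun x t => σ₁ x t i j) (sσ₁ i j) (pσ₁ t i j)
  have hσ₂ : ∀ i j, SmoothPeriodic (fun x => σ₂ x t i j) := fun i j =>
    SmoothPeriodic.of_slice (f := fun x t => σ₂ x t i j) (sσ₂ i j) (pσ₂ t i j)
  have hp : ∀ i, SmoothPeriodic (fun x => Jvec η u₁ t x i) := fun i => (hu₁ i).J3 hη hc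
  have hb : ∀ i, SmoothPeriodic (fun x => Jvec η u₂ t x i) := fun i => (hu₂ i).J3 hη hc
  have hk₁ : ∀ i, SmoothPeriodic (fun x => divJσ η σ₁ t x i) := fun i =>
    SmoothPeriodic.sum fun j => ((hσ₁ i j).J3 hη hc).pd j
  have hk₂ : ∀ i, SmoothPeriodic (fun x => divJσ η σ₂ t x i) := fun i =>
    SmoothPeriodic.sum fun j => ((hσ₂ i j).J3 hη hc).pd j
  have hv : ∀ i, SmoothPeriodic (fun x => u₂ x t i - u₁ x t i) := fun i => (hu₂ i).sub (hu₁ i)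
  have hw : ∀ i, SmoothPeriodic (fun x => ω₂ x t i - ω₁ x t i) := fun i => (hω₂ i).sub (hω₁ i)
  have hs : ∀ i j, SmoothPeriodic (fun x => σ₂ x t i j - σ₁ x t i j) := fun i j =>
    (hσ₂ i j).sub (hσ₁ i j)
  have ud := uniqueDiffOn_Icc hT t ht
  have edw : ∀ x i, deriv (fun s => ω₂ x s i - ω₁ x s i) t
      = α * lap (fun y => ω₂ y t i - ω₁ y t i) x
        - (∑ j, Jvec η u₂ t x j * pd j (fun y => ω₂ y t i - ω₁ y t i) x)
        - (∑ j, (Jvec η u₂ t x j - Jvec η u₁ t x j) * pd j (fun y => ω₁ y t i) x)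
        - Omg (fun y j => Jvec η u₂ t y j - Jvec η u₁ t y j) (fun y => u₂ y t) x i
        - Omg (Jvec η u₁ t) (fun y j => u₂ y t j - u₁ y t j) x i
        + β * curl3 (fun y j => divJσ η σ₂ t y j - divJσ η σ₁ t y j) x i := fun x i => by
    rw [ud.eq_deriv _ (dw x i).hasDerivWithinAt ((eω₂ x t ht i).sub (eω₁ x t ht i)),
      lap_sub (hω₂ i) (hω₁ i), curl3_sub hk₂ hk₁]
    have hO := Omg_sub_Omg hb hp hu₂ hu₁ x i
    simp only [pd_sub (hω₂ i) (hω₁ i), Fin.sum_univ_three]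
    linear_combination -hO
  have eds : ∀ x i j, deriv (fun s => σ₂ x s i j - σ₁ x s i j) t
      = ε * lap (fun y => σ₂ y t i j - σ₁ y t i j) x
        - (∑ k, Jvec η u₂ t x k * pd k (fun y => σ₂ y t i j - σ₁ y t i j) x)
        - (∑ k, (Jvec η u₂ t x k - Jvec η u₁ t x k) * pd k (fun y => σ₁ y t i j) x)
        + (∑ k, pd k (fun y => Jvec η u₂ t y i) x * (σ₂ x t k j - σ₁ x t k j))
        + (∑ k, pd k (fun y => Jvec η u₂ t y i - Jvec η u₁ t y i) x * σ₁ x t k j)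
        + (∑ k, (σ₂ x t i k - σ₁ x t i k) * pd k (fun y => Jvec η u₂ t y j) x)
        + (∑ k, σ₁ x t i k * pd k (fun y => Jvec η u₂ t y j - Jvec η u₁ t y j) x)
        - γ * (σ₂ x t i j - σ₁ x t i j) := fun x i j => by
    rw [ud.eq_deriv _ (ds x i j).hasDerivWithinAt ((eσ₂ x t ht i j).sub (eσ₁ x t ht i j)),
      lap_sub (hσ₂ i j) (hσ₁ i j)]
    simp only [pd_sub (hσ₂ i j) (hσ₁ i j), pd_sub (hb _) (hp _), Fin.sum_univ_three]
    ring
  set W := ∫ x in Set.Icc (0:V3) 1, ∑ i, (ω₂ x t i - ω₁ x t i) ^ 2 with hW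
  set S := ∫ x in Set.Icc (0:V3) 1, ∑ i, ∑ j, (σ₂ x t i j - σ₁ x t i j) ^ 2 with hS
  have W0 : 0 ≤ W := integral_nonneg fun x => Finset.sum_nonneg fun i _ => sq_nonneg _
  have S0 : 0 ≤ S := integral_nonneg fun x =>
    Finset.sum_nonneg fun i _ => Finset.sum_nonneg fun j _ => sq_nonneg _
  obtain ⟨bω₁, bω₂, bdω₁, bσ₁, bdσ₁⟩ := hbd t ht
  rw [Real.sqrt_le_left hM.le] at bω₁ bω₂ bdω₁ bσ₁ bdσ₁
  have hr := hrec t ht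
  have bv : (∫ x in Set.Icc (0:V3) 1, ∑ i, (u₂ x t i - u₁ x t i) ^ 2) ≤ Ct * W := by
    refine le_trans (le_add_of_nonneg_right ?_) hr
    exact integral_nonneg fun x => Finset.sum_nonneg fun i _ => Finset.sum_nonneg fun j _ =>
      sq_nonneg _
  have bdv : (∫ x in Set.Icc (0:V3) 1, ∑ i, ∑ j, (pd j (fun y => u₂ y t i - u₁ y t i) x) ^ 2)
      ≤ Ct * W := by
    refine le_trans (le_add_of_nonneg_left ?_) hr
    exact integral_nonneg fun x => Finset.sum_nonneg fun i _ => sq_nonneg _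
  have bdu₂ : (∫ x in Set.Icc (0:V3) 1, ∑ i, ∑ j, (pd j (fun y => u₂ y t i) x) ^ 2) ≤ M ^ 2 := by
    rw [integral_grad_sq_eq_integral_curl_sq hu₂ fun x => div₂ x t]
    simpa only [← curl₂] using bω₂
  have ea : ∀ j, (fun x => Jvec η u₂ t x j - Jvec η u₁ t x j)
      = J3 η (fun y => u₂ y t j - u₁ y t j) := fun j => funext fun x =>
    (J3_sub hη.continuous hc (hu₂ j).continuous (hu₁ j).continuous x).symm
  have bvj : ∀ j, K ^ 2 * (∫ x in Set.Icc (0:V3) 1, (u₂ x t j - u₁ x t j) ^ 2)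
      ≤ K ^ 2 * (Ct * W) := fun j =>
    mul_le_mul_of_nonneg_left ((integral_sq_le_integral_sum_sq
      (fun i => (hv i).continuous) j).trans bv) (sq_nonneg K)
  have ha : ∀ x j, (Jvec η u₂ t x j - Jvec η u₁ t x j) ^ 2 ≤ K ^ 2 * (Ct * W) := fun x j => by
    rw [show Jvec η u₂ t x j - Jvec η u₁ t x j = _ from congrFun (ea j) x]
    exact (sq_J3_le_and_sq_pd_J3_le hJ (hv j) x).1.trans (bvj j)
  have hda : ∀ x k j, (pd k (fun y => Jvec η u₂ t y j - Jvec η u₁ t y j) x) ^ 2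
      ≤ K ^ 2 * (Ct * W) := fun x k j => by
    rw [ea]
    exact ((sq_J3_le_and_sq_pd_J3_le hJ (hv j) x).2 k).trans (bvj j)
  have hdp : ∀ x k j, (pd k (fun y => Jvec η u₁ t y j) x) ^ 2 ≤ K ^ 2 * M ^ 2 := fun x k j => by
    refine (sq_pd_J3_le_of_curl hη hc hJ hu₁ (fun x => div₁ x t) x k j).trans
      (mul_le_mul_of_nonneg_left ?_ (sq_nonneg K))
    simpa only [← curl₁] using bω₁
  have hdb : ∀ x k j, (pd k (fun y => Jvec η u₂ t y j) x) ^ 2 ≤ K ^ 2 * M ^ 2 := fun x k j => by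
    refine (sq_pd_J3_le_of_curl hη hc hJ hu₂ (fun x => div₂ x t) x k j).trans
      (mul_le_mul_of_nonneg_left ?_ (sq_nonneg K))
    simpa only [← curl₂] using bω₂
  have hH : ∀ x i, (divJσ η σ₂ t x i - divJσ η σ₁ t x i) ^ 2 ≤ 9 * (K ^ 2 * S) := fun x i => by
    have e : divJσ η σ₂ t x i - divJσ η σ₁ t x i
        = ∑ j, pd j (J3 η (fun y => σ₂ y t i j - σ₁ y t i j)) x := by
      unfold divJσ
      rw [← Finset.sum_sub_distrib]
      refine Finset.sum_congr rfl fun j _ => ?_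
      rw [← pd_sub ((hσ₂ i j).J3 hη hc) ((hσ₁ i j).J3 hη hc)]
      congr 1
      exact funext fun y =>
        (J3_sub hη.continuous hc (hσ₂ i j).continuous (hσ₁ i j).continuous y).symm
    have hj : ∀ j, (pd j (J3 η (fun y => σ₂ y t i j - σ₁ y t i j)) x) ^ 2 ≤ K ^ 2 * S := fun j =>
      ((sq_J3_le_and_sq_pd_J3_le hJ (hs i j) x).2 j).trans
        (mul_le_mul_of_nonneg_left (integral_sq_le_integral_sum_sum_sq
          (fun i j => (hs i j).continuous) i j) (sq_nonneg K))
    rw [e]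
    refine (sq_sum_le_card_mul_sum_sq).trans ?_
    have := Finset.sum_le_sum fun j (_ : j ∈ Finset.univ) => hj j
    simp only [Finset.sum_const, Finset.card_univ, Fintype.card_fin, nsmul_eq_mul] at this ⊢
    push_cast at this ⊢
    linarith
  have A0 : 0 ≤ K ^ 2 * (Ct * W) := by positivity
  have B0 : 0 ≤ K ^ 2 * M ^ 2 := by positivity
  have vort := vorticity_energy_bound (β := β)
    (w := fun x i => ω₂ x t i - ω₁ x t i) (om := fun x => ω₁ x t) (u := fun x => u₂ x t)
    (v := fun x i => u₂ x t i - u₁ x t i) (a := fun x i => Jvec η u₂ t x i - Jvec η u₁ t x i)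
    (b := Jvec η u₂ t) (p := Jvec η u₁ t)
    (h := fun x i => divJσ η σ₂ t x i - divJσ η σ₁ t x i)
    (d := fun x i => deriv (fun s => ω₂ x s i - ω₁ x s i) t)
    hα A0 B0 hw hω₁ hu₂ hv hb (fun i => (hk₂ i).sub (hk₁ i))
    (fun i => (continuous_deriv_snd (g := fun x s => ω₂ x s i - ω₁ x s i) (sw i)).comp
      (Continuous.prodMk_left t))
    (sum_pd_J3_eq_zero hη hc hu₂ fun x => div₂ x t) edw ha hda hdp hH
  have stress := stress_energy_bound
    (s := fun x i j => σ₂ x t i j - σ₁ x t i j) (σ := fun x => σ₁ x t)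
    (a := fun x i => Jvec η u₂ t x i - Jvec η u₁ t x i) (b := Jvec η u₂ t)
    (d := fun x i j => deriv (fun s => σ₂ x s i j - σ₁ x s i j) t)
    hε hγ hs hσ₁ hb
    (fun i j => (continuous_deriv_snd (g := fun x s => σ₂ x s i j - σ₁ x s i j) (ss i j)).comp
      (Continuous.prodMk_left t))
    (sum_pd_J3_eq_zero hη hc hu₂ fun x => div₂ x t) eds ha hda hdb
  rw [← hW] at vort
  rw [← hS] at stress
  have m1 := mul_le_mul_of_nonneg_left bdω₁ A0
  have m2 := mul_le_mul_of_nonneg_left bdu₂ A0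
  have m3 := mul_le_mul_of_nonneg_left bdv B0
  have m4 := mul_le_mul_of_nonneg_left bσ₁ A0
  have m5 := mul_le_mul_of_nonneg_left bdσ₁ A0
  refine (add_le_add vort stress).trans ?_
  have r1 : 0 ≤ K ^ 2 * M ^ 2 * Ct * S := by positivity
  have r2 : 0 ≤ 27 * β ^ 2 / α * K ^ 2 * W := by positivity
  have r3 : 0 ≤ K ^ 2 * M ^ 2 * W := by positivity
  have r4 : 3 * (β ^ 2 / α * (9 * (K ^ 2 * S))) = 27 * β ^ 2 / α * K ^ 2 * S := by ring
  rw [r4]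
  simp only [Pi.add_apply, ← hW, ← hS]
  linarith
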